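/- There exists a P-bilinear map ψ₁⁽⁰⁾ : F₁ × F₁ → F₂ (not necessarily alternating) which is 2-compatible; that is, d₂(ψ₁⁽⁰⁾(x₁,y₁)) = 2·(d₁(x₁)·y₁ − d₁(y₁)·x₁) for all x₁, y₁ ∈ F₁, and ψ̄₄(ψ₁⁽⁰⁾(x₁, d₂x₂), x₂) = 2·d₁(x₁)·ψ₄(x₂) for all x₁ ∈ F₁, x₂ ∈ F₂. -/

import Mathlib

open QuadraticMap LinearMap Submodule Function

/-- A map from a projective module that composes to zero with the second map of an exact pair lifts
along the first. -/
theorem exists_lift_of_range_eq_ker {P A B C N : Type*} [CommRing P]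
    [AddCommGroup A] [Module P A] [AddCommGroup B] [Module P B] [AddCommGroup C] [Module P C]
    [AddCommGroup N] [Module P N] [Module.Projective P N]
    (f : A →ₗ[P] B) (g : B →ₗ[P] C) (hfg : LinearMap.range f = LinearMap.ker g)
    (h : N →ₗ[P] B) (hh : ∀ n, g (h n) = 0) : ∃ l : N →ₗ[P] A, ∀ n, f (l n) = h n := by
  have hr : ∀ n, h n ∈ LinearMap.range f := fun n => by rw [hfg]; exact hh n
  obtain ⟨l, hl⟩ := Module.projective_lifting_property f.rangeRestrict
    (h.codRestrict _ hr) f.surjective_rangeRestrict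
  exact ⟨l, fun n => congrArg Subtype.val (LinearMap.congr_fun hl n)⟩

section SelfDual

variable {P F1 F2 F3 F4 : Type*} [CommRing P]
  [AddCommGroup F1] [Module P F1] [AddCommGroup F2] [Module P F2]
  [AddCommGroup F3] [Module P F3] [AddCommGroup F4] [Module P F4]
  {d1 : F1 →ₗ[P] P} {d2 : F2 →ₗ[P] F1} {d3 : F3 →ₗ[P] F2} {d4 : F4 →ₗ[P] F3}
  {ψ3 : F1 →ₗ[P] F3 →ₗ[P] F4} {β : F2 →ₗ[P] F2 →ₗ[P] F4}

/-- Exactness of the dual complex at `Hom(F2, F4)`, for families of functionals indexed by a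
projective module. -/
theorem exists_dual_lift (hex2 : LinearMap.range d3 = LinearMap.ker d2)
    (hsymm : ∀ u v, β u v = β v u) (hA3 : ∀ u w, β u (d3 w) = - ψ3 (d2 u) w)
    (hψ3 : Injective ψ3) (hβ : Bijective β)
    {N : Type*} [AddCommGroup N] [Module P N] [Module.Projective P N]
    (f : N →ₗ[P] F2 →ₗ[P] F4) (hf : ∀ n w, f n (d3 w) = 0) :
    ∃ c : N →ₗ[P] F3, ∀ n u, f n u = ψ3 (d2 u) (c n) := by
  let b : N →ₗ[P] F2 := (LinearEquiv.ofBijective β hβ).symm.toLinearMap ∘ₗ f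
  have hb : ∀ n, β (b n) = f n := fun n =>
    (LinearEquiv.ofBijective β hβ).apply_symm_apply (f n)
  obtain ⟨c, hc⟩ := exists_lift_of_range_eq_ker d3 d2 hex2 b fun n => hψ3 <| by
    ext w
    have := hA3 (b n) w
    rw [hb, hf] at this
    simpa using this.symm
  refine ⟨-c, fun n u => ?_⟩
  rw [← hb, ← hc, hsymm, hA3]
  simp

/-- A symmetric bilinear form on `F2` that vanishes on the image of `d3` comes from a bilinear form
on `F1`. -/
theorem exists_form_descent [Module.Projective P F1] [Module.Projective P F2]
    [Module.Projective P F3]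
    (hd21 : ∀ x2, d1 (d2 x2) = 0) (hd43 : ∀ x4, d3 (d4 x4) = 0) (hinj4 : Injective d4)
    (hex3 : LinearMap.range d4 = LinearMap.ker d3)
    (hex2 : LinearMap.range d3 = LinearMap.ker d2)
    (hex1 : LinearMap.range d2 = LinearMap.ker d1)
    (e : F4 ≃ₗ[P] P)
    (hA2 : ∀ x1 x4, ψ3 x1 (d4 x4) = d1 x1 • x4)
    (hsymm : ∀ u v, β u v = β v u) (hA3 : ∀ u w, β u (d3 w) = - ψ3 (d2 u) w)
    (hψ3 : Bijective ψ3) (hβ : Bijective β)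
    (B : F2 →ₗ[P] F2 →ₗ[P] F4) (hBsymm : ∀ u v, B u v = B v u)
    (hB : ∀ u w, B u (d3 w) = 0) :
    ∃ γ : F1 →ₗ[P] F3, ∀ u v, B u v = ψ3 (d2 u) (γ (d2 v)) := by
  obtain ⟨g, hg⟩ := exists_dual_lift hex2 hsymm hA3 hψ3.1 hβ B hB
  have hgd : ∀ w, d3 (g (d3 w)) = 0 := fun w => hβ.1 <| by
    ext v
    rw [hsymm, hA3, ← hg, hBsymm, hB]
    simp
  obtain ⟨k, hk⟩ := exists_lift_of_range_eq_ker d4 d3 hex3 (g ∘ₗ d3) hgd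
  obtain ⟨a, ha⟩ := hψ3.2 k
  have hda : d1 a = 0 := by
    have hz : k (d4 (e.symm 1)) = 0 := hinj4 <| by rw [hk]; simp [hd43]
    rw [← ha, hA2] at hz
    simpa using congrArg e hz
  obtain ⟨b, hb⟩ : a ∈ LinearMap.range d2 := by rw [hex1]; exact hda
  let g' : F2 →ₗ[P] F3 := g + d4 ∘ₗ β b
  have hg'd : ∀ w, g' (d3 w) = 0 := fun w => by
    have := hk w
    simp only [LinearMap.comp_apply] at this
    simp [g', hA3, hb, ha, this]
  have hg' : ∀ u v, B u v = ψ3 (d2 v) (g' u) := fun u v => by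
    simp [g', hg, hA2, hd21]
  obtain ⟨γ, hγ⟩ := exists_dual_lift hex2 hsymm hA3 hψ3.1 hβ (ψ3.compl₂ g')
    fun y w => by simp [hg'd]
  exact ⟨γ, fun u v => by rw [hg', ← hγ]; rfl⟩

end SelfDual

theorem stmt_6
    (P : Type*) [CommRing P] [IsNoetherianRing P]
    (F1 F2 F3 F4 : Type*)
    [AddCommGroup F1] [Module P F1] [Module.Free P F1] [Module.Finite P F1]
    [AddCommGroup F2] [Module P F2] [Module.Free P F2] [Module.Finite P F2]
    [AddCommGroup F3] [Module P F3] [Module.Free P F3] [Module.Finite P F3]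
    [AddCommGroup F4] [Module P F4] [Module.Free P F4] [Module.Finite P F4]
    (d1 : F1 →ₗ[P] P) (d2 : F2 →ₗ[P] F1) (d3 : F3 →ₗ[P] F2) (d4 : F4 →ₗ[P] F3)
    (hd21 : ∀ x2, d1 (d2 x2) = 0) (hd32 : ∀ x3, d2 (d3 x3) = 0)
    (hd43 : ∀ x4, d3 (d4 x4) = 0)
    (hinj4 : Function.Injective d4)
    (hex3 : LinearMap.range d4 = LinearMap.ker d3)
    (hex2 : LinearMap.range d3 = LinearMap.ker d2)
    (hex1 : LinearMap.range d2 = LinearMap.ker d1)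
    (hrank : Nonempty (F4 ≃ₗ[P] P))
    (ψ3 : F1 →ₗ[P] F3 →ₗ[P] F4) (ψ4 : QuadraticMap P F2 F4)
    (hA2 : ∀ x1 x4, ψ3 x1 (d4 x4) = d1 x1 • x4)
    (hA3 : ∀ x2 x3, polar ψ4 x2 (d3 x3) = - ψ3 (d2 x2) x3)
    (hiso1 : Function.Bijective ψ3)
    (hiso2 : Function.Bijective (polarBilin ψ4))
    (hiso3 : Function.Bijective ψ3.flip)
    (hreg : ∃ x1, d1 x1 ∈ nonZeroDivisors P)
    : ∃ ψ10 : F1 →ₗ[P] F1 →ₗ[P] F2,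
      (∀ x1 y1, d2 (ψ10 x1 y1) = (2 : ℤ) • (d1 x1 • y1 - d1 y1 • x1)) ∧
      (∀ x1 x2, polar ψ4 (ψ10 x1 (d2 x2)) x2 = (2 : ℤ) • (d1 x1 • ψ4 x2)) := by
  obtain ⟨e⟩ := hrank
  let β : F2 →ₗ[P] F2 →ₗ[P] F4 := polarBilin ψ4
  have hβ : ∀ u v, polar ψ4 u v = β u v := fun _ _ => rfl
  have hsymm : ∀ u v, β u v = β v u := fun u v => polar_comm ψ4 u v
  have hself : ∀ u, β u u = (2 : ℤ) • ψ4 u := fun u => by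
    rw [← hβ, polar_self, two_smul, two_smul]
  have hA3' : ∀ u w, β u (d3 w) = - ψ3 (d2 u) w := hA3
  have key : ∀ x : F1, ∃ X : F1 →ₗ[P] F2,
      (∀ y, d2 (X y) = (2 : ℤ) • (d1 x • y - d1 y • x)) ∧
      ∀ u, β (X (d2 u)) u = (2 : ℤ) • (d1 x • ψ4 u) := by
    intro x
    obtain ⟨φ, hφ⟩ := exists_lift_of_range_eq_ker d2 d1 hex1
      (d1 x • LinearMap.id - d1.smulRight x) fun y => by simp [mul_comm]
    replace hφ : ∀ y, d2 (φ y) = d1 x • y - d1 y • x := fun y => by simpa using hφ y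
    let A : F2 →ₗ[P] F2 →ₗ[P] F4 := β ∘ₗ φ ∘ₗ d2
    let B : F2 →ₗ[P] F2 →ₗ[P] F4 := A + A.flip - d1 x • β
    have hB : ∀ u v, B u v = β (φ (d2 u)) v + β (φ (d2 v)) u - d1 x • β u v :=
      fun _ _ => rfl
    obtain ⟨γ, hγ⟩ := exists_form_descent hd21 hd43 hinj4 hex3 hex2 hex1 e hA2 hsymm hA3'
      hiso1 hiso2 B (fun u v => by rw [hB, hB, hsymm u v]; abel)
      (fun u w => by rw [hB, hA3', hA3', hφ, hd21, hd32]; simp)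
    refine ⟨(2 : ℤ) • φ + d3 ∘ₗ γ, fun y => by simp [hφ, hd32], fun u => ?_⟩
    have h := hγ u u
    rw [hB, hself] at h
    simp only [LinearMap.add_apply, LinearMap.smul_apply, LinearMap.comp_apply, map_add,
      map_zsmul]
    rw [hsymm (d3 _), hA3', ← h, smul_comm (2 : ℤ) (d1 x)]
    abel
  choose X hX1 hX2 using key
  let b := Module.Free.chooseBasis P F1
  let ψ := b.constr ℕ fun i => X (b i)
  have hψ : ∀ i, ψ (b i) = X (b i) := fun i => b.constr_basis ℕ _ i
  refine ⟨ψ, fun x y => ?_, fun x u => ?_⟩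
  · have : (ψ.compr₂ d2).flip y =
        (2 : ℤ) • (d1.smulRight y - d1 y • LinearMap.id) := b.ext fun i => by
      simp [hψ, hX1, two_smul]
    simpa [two_smul] using LinearMap.congr_fun this x
  · have : β.flip u ∘ₗ ψ.flip (d2 u) = (2 : ℤ) • d1.smulRight (ψ4 u) := b.ext fun i => by
      simp [hψ, hX2, two_smul]
    rw [hβ]
    simpa [two_smul] using LinearMap.congr_fun this x
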